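/- The number of elements w of the affine Weyl group Aff W satisfying w⁻¹C ⊆ 2C is exactly 2^ℓ, where ℓ is the rank of 𝔤; that is, #Aff'₂(W) = 2^ℓ where Aff'₂(W) := { w ∈ Aff W : w⁻¹C ⊆ 2C }. -/

import Mathlib

open scoped RealInnerProductSpace Pointwise

namespace AffineWeyl

variable {V : Type*} [NormedAddCommGroup V] [InnerProductSpace ℝ V]

/-- The affine function `v ↦ ⟪β, v⟫ + n` attached to a pair `(β, n)`. -/
noncomputable def ev (a : V × ℤ) (v : V) : ℝ := ⟪a.1, v⟫ + a.2

/-- The orthogonal reflection in the zero set of the affine function `ev b`. -/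
noncomputable def affineReflection (b : V × ℤ) : V ≃ᵃ[ℝ] V :=
  ((ℝ ∙ b.1)ᗮ.reflection.toLinearEquiv.toAffineEquiv).trans
    (AffineEquiv.constVAdd ℝ V (-((2 * b.2 / ⟪b.1, b.1⟫ : ℝ) • b.1)))

/-- The integral Cartan pairing of the gradients of `a` and `b`. -/
noncomputable def pairing (b a : V × ℤ) : ℤ := ⌊2 * ⟪b.1, a.1⟫ / ⟪b.1, b.1⟫⌋

/-- The affine function `a` composed with the reflection `b`. -/
noncomputable def reflect (b a : V × ℤ) : V × ℤ := a - pairing b a • b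

/-- The affine roots attached to a finite set of vectors. -/
def affineRoots (Φ : Finset V) : Set (V × ℤ) := {a | a.1 ∈ Φ}

lemma affineReflection_apply_eq (b : V × ℤ) (v : V) :
    affineReflection b v =
      -((2 * b.2 / ⟪b.1, b.1⟫ : ℝ) • b.1) + (ℝ ∙ b.1)ᗮ.reflection v := rfl

lemma affineReflection_apply (b : V × ℤ) (v : V) :
    affineReflection b v = v - (2 * ev b v / ⟪b.1, b.1⟫) • b.1 := by
  rw [affineReflection_apply_eq, Submodule.reflection_orthogonal_apply,
    Submodule.reflection_singleton_apply, ev]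
  simp only [RCLike.ofReal_real_eq_id, id, ← real_inner_self_eq_norm_sq]
  module

lemma affineReflection_neg (b : V × ℤ) : affineReflection (-b) = affineReflection b := by
  ext v
  simp only [affineReflection_apply, ev, Prod.fst_neg, Prod.snd_neg, inner_neg_left,
    inner_neg_right, neg_neg, Int.cast_neg]
  module

lemma ev_add (a b : V × ℤ) (v : V) : ev (a + b) v = ev a v + ev b v := by
  simp only [ev, Prod.fst_add, Prod.snd_add, inner_add_left, Int.cast_add]; ring

lemma ev_neg (a : V × ℤ) (v : V) : ev (-a) v = - ev a v := by
  simp only [ev, Prod.fst_neg, Prod.snd_neg, inner_neg_left, Int.cast_neg]; ring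

lemma ev_zsmul (k : ℤ) (a : V × ℤ) (v : V) : ev (k • a) v = k * ev a v := by
  simp only [ev, Prod.smul_fst, Prod.smul_snd, ← Int.cast_smul_eq_zsmul ℝ k a.1,
    real_inner_smul_left, smul_eq_mul, Int.cast_mul]; ring

lemma ev_sum_nsmul {ι : Type*} [Fintype ι] (c : ι → ℕ) (f : ι → V × ℤ) (v : V) :
    ev (∑ i, c i • f i) v = ∑ i, (c i : ℝ) * ev (f i) v := by
  simp only [ev, Prod.fst_sum, Prod.snd_sum, sum_inner, Int.cast_sum, Prod.smul_fst,
    Prod.smul_snd, ← Nat.cast_smul_eq_nsmul ℝ, real_inner_smul_left, nsmul_eq_mul,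
    Int.cast_mul, Int.cast_natCast, ← Finset.sum_add_distrib, mul_add]

lemma ev_injective : Function.Injective (ev : V × ℤ → V → ℝ) := by
  intro a b h
  have h0 : a.2 = b.2 := by simpa [ev] using congrFun h 0
  refine Prod.ext (ext_inner_right ℝ fun v ↦ ?_) h0
  simpa [ev, h0] using congrFun h v

lemma continuous_ev (a : V × ℤ) : Continuous (ev a) := by
  unfold ev; fun_prop

lemma ev_affineReflection_self {b : V × ℤ} (hb : b.1 ≠ 0) (v : V) :
    ev b (affineReflection b v) = - ev b v := by
  have : (⟪b.1, b.1⟫ : ℝ) ≠ 0 := inner_self_ne_zero.2 hb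
  rw [affineReflection_apply]
  simp only [ev, inner_sub_right, real_inner_smul_right]
  field_simp
  ring

lemma affineReflection_affineReflection {b : V × ℤ} (hb : b.1 ≠ 0) (v : V) :
    affineReflection b (affineReflection b v) = v := by
  rw [affineReflection_apply b (affineReflection b v), ev_affineReflection_self hb,
    affineReflection_apply]
  module

lemma affineReflection_mul_self {b : V × ℤ} (hb : b.1 ≠ 0) :
    affineReflection b * affineReflection b = 1 := by
  ext v
  exact affineReflection_affineReflection hb v

lemma affineReflection_inv {b : V × ℤ} (hb : b.1 ≠ 0) :
    (affineReflection b)⁻¹ = affineReflection b :=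
  inv_eq_of_mul_eq_one_left (affineReflection_mul_self hb)

lemma ev_reflect_of_pairing {b a : V × ℤ}
    (h : (pairing b a : ℝ) = 2 * ⟪b.1, a.1⟫ / ⟪b.1, b.1⟫) (v : V) :
    ev (reflect b a) v = ev a (affineReflection b v) := by
  rw [reflect, sub_eq_add_neg, ev_add, ev_neg, ev_zsmul, h, affineReflection_apply]
  simp only [ev, inner_sub_right, real_inner_smul_right, real_inner_comm]
  ring

lemma affineReflection_mul_of_pairing {b a : V × ℤ} (hb : b.1 ≠ 0)
    (h : (pairing b a : ℝ) = 2 * ⟪b.1, a.1⟫ / ⟪b.1, b.1⟫) :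
    affineReflection a * affineReflection b =
      affineReflection b * affineReflection (reflect b a) := by
  have hbb : (⟪b.1, b.1⟫ : ℝ) ≠ 0 := inner_self_ne_zero.2 hb
  have h1 : (reflect b a).1 = a.1 - (2 * ⟪b.1, a.1⟫ / ⟪b.1, b.1⟫) • b.1 := by
    rw [← h, Int.cast_smul_eq_zsmul]
    simp [reflect]
  have h2 : ⟪(reflect b a).1, (reflect b a).1⟫ = ⟪a.1, a.1⟫ := by
    simp only [h1, inner_sub_left, inner_sub_right, real_inner_smul_left, real_inner_smul_right,
      real_inner_comm b.1 a.1]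
    field_simp
    ring
  ext v
  change affineReflection a (affineReflection b v) =
    affineReflection b (affineReflection (reflect b a) v)
  rw [affineReflection_apply (reflect b a), ev_reflect_of_pairing h, h2,
    affineReflection_apply a]
  generalize 2 * ev a (affineReflection b v) / ⟪a.1, a.1⟫ = t
  rw [h1, affineReflection_apply b v, affineReflection_apply b]
  simp only [ev, inner_sub_right, real_inner_smul_right]
  generalize (⟪b.1, a.1⟫ : ℝ) = p
  match_scalars
  · ring
  · field_simp
    ring
  · ring

lemma volume_image_affineReflection [FiniteDimensional ℝ V] [MeasurableSpace V] [BorelSpace V]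
    (b : V × ℤ) (s : Set V) :
    MeasureTheory.volume (affineReflection b '' s) = MeasureTheory.volume s := by
  have : affineReflection b '' s = (fun x ↦ -((2 * b.2 / ⟪b.1, b.1⟫ : ℝ) • b.1) + x) ''
      ((ℝ ∙ b.1)ᗮ.reflection '' s) := by
    rw [Set.image_image]; rfl
  rw [this, Set.image_add_left, MeasureTheory.measure_preimage_add,
    LinearIsometryEquiv.image_eq_preimage_symm]
  exact (LinearIsometryEquiv.measurePreserving _).measure_preimage_emb
    (ℝ ∙ b.1)ᗮ.reflection.symm.toMeasurableEquiv.measurableEmbedding s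

/-- A family `f` of simple affine roots for the affine root system of `Φ`. -/
structure IsSimpleAffineSystem (Φ : Finset V) {ι : Type*} [Fintype ι] (f : ι → V × ℤ) :
    Prop where
  zero_notMem : (0 : V) ∉ Φ
  neg_mem : ∀ β ∈ Φ, -β ∈ Φ
  reduced : ∀ β ∈ Φ, ∀ c : ℝ, c • β ∈ Φ → c = 1 ∨ c = -1
  crystallographic : ∀ β ∈ Φ, ∀ γ ∈ Φ, ∃ n : ℤ, 2 * ⟪β, γ⟫ / ⟪β, β⟫ = (n : ℝ)
  reflection_mem : ∀ β ∈ Φ, ∀ γ ∈ Φ, γ - (2 * ⟪β, γ⟫ / ⟪β, β⟫) • β ∈ Φ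
  mem : ∀ i, f i ∈ affineRoots Φ
  pos_or_neg : ∀ a ∈ affineRoots Φ,
    (∃ c : ι → ℕ, a = ∑ i, c i • f i) ∨ ∃ c : ι → ℕ, -a = ∑ i, c i • f i
  exists_vertex : ∀ J : Set ι, J.Nonempty →
    ∃ v, ∀ i, (i ∈ J → 0 < ev (f i) v) ∧ (i ∉ J → ev (f i) v = 0)
  nontrivial : Nontrivial ι
  exists_inner_pos : ∀ β ∈ Φ, ∃ i, 0 < ⟪(f i).1, β⟫
  isBounded : Bornology.IsBounded {v | ∀ i, 0 ≤ ev (f i) v}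

/-- The closed fundamental alcove. -/
def alcove {ι : Type*} (f : ι → V × ℤ) : Set V := {v | ∀ i, 0 ≤ ev (f i) v}

/-- The open fundamental alcove. -/
def openAlcove {ι : Type*} (f : ι → V × ℤ) : Set V := {v | ∀ i, 0 < ev (f i) v}

lemma openAlcove_subset {ι : Type*} {f : ι → V × ℤ} : openAlcove f ⊆ alcove f :=
  fun _ hv i ↦ (hv i).le

/-- The affine root with the same gradient as `a` whose zero set is dilated by `m`. -/
def dilate (m : ℕ) (a : V × ℤ) : V × ℤ := (a.1, m * a.2)

lemma ev_dilate {m : ℕ} (hm : m ≠ 0) (a : V × ℤ) (v : V) :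
    ev (dilate m a) v = m * ev a ((m : ℝ)⁻¹ • v) := by
  have : (m : ℝ) ≠ 0 := Nat.cast_ne_zero.2 hm
  simp only [ev, dilate, real_inner_smul_right, Int.cast_mul, Int.cast_natCast]
  field_simp

lemma mem_smul_alcove {ι : Type*} {f : ι → V × ℤ} {m : ℕ} (hm : m ≠ 0) {v : V} :
    v ∈ (m : ℝ) • alcove f ↔ ∀ i, 0 ≤ ev (dilate m (f i)) v := by
  have : (0 : ℝ) < m := Nat.cast_pos.2 (Nat.pos_of_ne_zero hm)
  rw [Set.mem_smul_set_iff_inv_smul_mem₀ this.ne']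
  simp only [ev_dilate hm, mul_nonneg_iff_of_pos_left this]
  rfl

lemma mem_smul_openAlcove {ι : Type*} {f : ι → V × ℤ} {m : ℕ} (hm : m ≠ 0) {v : V} :
    v ∈ (m : ℝ) • openAlcove f ↔ ∀ i, 0 < ev (dilate m (f i)) v := by
  have : (0 : ℝ) < m := Nat.cast_pos.2 (Nat.pos_of_ne_zero hm)
  rw [Set.mem_smul_set_iff_inv_smul_mem₀ this.ne']
  simp only [ev_dilate hm, mul_pos_iff_of_pos_left this]
  rfl

/-- The group generated by the simple affine reflections. -/
def simpleGroup {ι : Type*} (f : ι → V × ℤ) : Subgroup (V ≃ᵃ[ℝ] V) :=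
  Subgroup.closure (Set.range fun i ↦ affineReflection (f i))

/-- The product of the simple affine reflections along a word. -/
noncomputable def wordProd {ι : Type*} (f : ι → V × ℤ) (L : List ι) : V ≃ᵃ[ℝ] V :=
  (L.map fun i ↦ affineReflection (f i)).prod

namespace IsSimpleAffineSystem

variable {Φ : Finset V} {ι : Type*} [Fintype ι] {f : ι → V × ℤ}

lemma fst_ne_zero (hf : IsSimpleAffineSystem Φ f) {a : V × ℤ} (ha : a ∈ affineRoots Φ) :
    a.1 ≠ 0 := fun h ↦ hf.zero_notMem (h ▸ ha)

lemma neg_mem_affineRoots (hf : IsSimpleAffineSystem Φ f) {a : V × ℤ} (ha : a ∈ affineRoots Φ) :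
    -a ∈ affineRoots Φ := hf.neg_mem _ ha

lemma pairing_cast (hf : IsSimpleAffineSystem Φ f) {a b : V × ℤ} (hb : b ∈ affineRoots Φ)
    (ha : a ∈ affineRoots Φ) : (pairing b a : ℝ) = 2 * ⟪b.1, a.1⟫ / ⟪b.1, b.1⟫ := by
  obtain ⟨n, hn⟩ := hf.crystallographic _ hb _ ha
  rw [pairing, hn, Int.floor_intCast]

lemma reflect_mem (hf : IsSimpleAffineSystem Φ f) {a b : V × ℤ} (hb : b ∈ affineRoots Φ)
    (ha : a ∈ affineRoots Φ) : reflect b a ∈ affineRoots Φ := by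
  have := hf.reflection_mem _ hb _ ha
  rw [← hf.pairing_cast hb ha, Int.cast_smul_eq_zsmul] at this
  simpa [reflect, affineRoots] using this

lemma ev_reflect (hf : IsSimpleAffineSystem Φ f) {a b : V × ℤ} (hb : b ∈ affineRoots Φ)
    (ha : a ∈ affineRoots Φ) (v : V) : ev (reflect b a) v = ev a (affineReflection b v) :=
  ev_reflect_of_pairing (hf.pairing_cast hb ha) v

lemma affineReflection_mul (hf : IsSimpleAffineSystem Φ f) {a b : V × ℤ} (hb : b ∈ affineRoots Φ)
    (ha : a ∈ affineRoots Φ) : affineReflection a * affineReflection b =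
      affineReflection b * affineReflection (reflect b a) :=
  affineReflection_mul_of_pairing (hf.fst_ne_zero hb) (hf.pairing_cast hb ha)

lemma openAlcove_nonempty (hf : IsSimpleAffineSystem Φ f) : (openAlcove f).Nonempty := by
  have := hf.nontrivial
  obtain ⟨v, hv⟩ := hf.exists_vertex Set.univ Set.univ_nonempty
  exact ⟨v, fun i ↦ (hv i).1 trivial⟩

lemma exists_eq_sum_of_ev_pos (hf : IsSimpleAffineSystem Φ f) {a : V × ℤ}
    (ha : a ∈ affineRoots Φ) {x : V} (hx : x ∈ alcove f) (hax : 0 < ev a x) :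
    ∃ c : ι → ℕ, a = ∑ i, c i • f i := by
  refine (hf.pos_or_neg a ha).resolve_right ?_
  rintro ⟨c, hc⟩
  have h1 := ev_neg a x
  rw [hc, ev_sum_nsmul] at h1
  have := Finset.sum_nonneg fun i (_ : i ∈ Finset.univ) ↦
    mul_nonneg (Nat.cast_nonneg (α := ℝ) (c i)) (hx i)
  linarith

lemma ev_nonneg_of_ev_pos (hf : IsSimpleAffineSystem Φ f) {a : V × ℤ}
    (ha : a ∈ affineRoots Φ) {x y : V} (hx : x ∈ alcove f) (hax : 0 < ev a x)
    (hy : y ∈ alcove f) : 0 ≤ ev a y := by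
  obtain ⟨c, rfl⟩ := hf.exists_eq_sum_of_ev_pos ha hx hax
  rw [ev_sum_nsmul]
  exact Finset.sum_nonneg fun i _ ↦ mul_nonneg (Nat.cast_nonneg (α := ℝ) (c i)) (hy i)

lemma ev_pos_of_ne_zero_coeff {c : ι → ℕ} {y : V} (hy : y ∈ alcove f) {i : ι}
    (hi : c i ≠ 0) (hyi : 0 < ev (f i) y) : 0 < ev (∑ i, c i • f i) y := by
  rw [ev_sum_nsmul]
  exact Finset.sum_pos' (fun i _ ↦ mul_nonneg (Nat.cast_nonneg (α := ℝ) (c i)) (hy i))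
    ⟨i, Finset.mem_univ _, mul_pos (by exact_mod_cast Nat.pos_of_ne_zero hi) hyi⟩

lemma ev_pos_of_ev_pos (hf : IsSimpleAffineSystem Φ f) {a : V × ℤ}
    (ha : a ∈ affineRoots Φ) {x y : V} (hx : x ∈ alcove f) (hax : 0 < ev a x)
    (hy : y ∈ openAlcove f) : 0 < ev a y := by
  obtain ⟨c, rfl⟩ := hf.exists_eq_sum_of_ev_pos ha hx hax
  obtain ⟨i, hi⟩ : ∃ i, c i ≠ 0 := by
    by_contra! h
    simp [h, ev] at hax
  exact ev_pos_of_ne_zero_coeff (openAlcove_subset hy) hi (hy i)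

lemma ev_ne_zero (hf : IsSimpleAffineSystem Φ f) {a : V × ℤ} (ha : a ∈ affineRoots Φ) {x : V}
    (hx : x ∈ openAlcove f) : ev a x ≠ 0 := by
  have key : ∀ b ∈ affineRoots Φ, (∃ c : ι → ℕ, b = ∑ i, c i • f i) → 0 < ev b x := by
    rintro b hb ⟨c, rfl⟩
    obtain ⟨i, hi⟩ : ∃ i, c i ≠ 0 := by
      by_contra! h
      exact hf.fst_ne_zero hb (by simp [h])
    exact ev_pos_of_ne_zero_coeff (openAlcove_subset hx) hi (hx i)
  rcases hf.pos_or_neg a ha with h | h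
  · exact (key a ha h).ne'
  · have := key _ (hf.neg_mem_affineRoots ha) h
    rw [ev_neg] at this
    linarith

/-- A simple affine reflection permutes the positive affine roots other than its own. -/
lemma reflect_pos (hf : IsSimpleAffineSystem Φ f) {a : V × ℤ} (ha : a ∈ affineRoots Φ)
    {x : V} (hx : x ∈ openAlcove f) (hax : 0 < ev a x) {i : ι} (hi : a ≠ f i) :
    0 < ev a (affineReflection (f i) x) := by
  have := hf.nontrivial
  obtain ⟨c, hc⟩ := hf.exists_eq_sum_of_ev_pos ha (openAlcove_subset hx) hax
  obtain ⟨j, hji, hj⟩ : ∃ j, j ≠ i ∧ c j ≠ 0 := by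
    by_contra! h
    have hac : a = c i • f i := by
      rw [hc]
      exact Finset.sum_eq_single i (fun j _ hj ↦ by simp [h j hj]) (by simp)
    have h1 : (c i : ℝ) • (f i).1 ∈ Φ := by
      rw [Nat.cast_smul_eq_nsmul, ← Prod.smul_fst, ← hac]
      exact ha
    rcases hf.reduced _ (hf.mem i) _ h1 with h2 | h2
    · rw [Nat.cast_eq_one.1 h2, one_smul] at hac
      exact hi hac
    · have : (0 : ℝ) ≤ c i := Nat.cast_nonneg _
      linarith
  obtain ⟨p, hp⟩ := hf.exists_vertex {i}ᶜ (exists_ne i)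
  have hpi : ev (f i) p = 0 := (hp i).2 (by simp)
  have hpC : p ∈ alcove f := fun k ↦ by
    by_cases hk : k = i
    · rw [hk, hpi]
    · exact ((hp k).1 hk).le
  have hap : 0 < ev a p := by
    rw [hc]
    exact ev_pos_of_ne_zero_coeff hpC hj ((hp j).1 hji)
  have hfix : affineReflection (f i) p = p := by
    rw [affineReflection_apply, hpi]
    simp
  rw [← hfix, ← hf.ev_reflect (hf.mem i) ha] at hap
  rw [← hf.ev_reflect (hf.mem i) ha]
  exact hf.ev_pos_of_ev_pos (hf.reflect_mem (hf.mem i) ha) hpC hap hx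

lemma inv_affineReflection (hf : IsSimpleAffineSystem Φ f) (i : ι) :
    (affineReflection (f i))⁻¹ = affineReflection (f i) :=
  affineReflection_inv (hf.fst_ne_zero (hf.mem i))

lemma exists_wordProd_eq (hf : IsSimpleAffineSystem Φ f) {g : V ≃ᵃ[ℝ] V}
    (hg : g ∈ simpleGroup f) : ∃ L, wordProd f L = g := by
  induction hg using Subgroup.closure_induction with
  | mem g hg =>
    obtain ⟨i, rfl⟩ := hg
    exact ⟨[i], by simp [wordProd]⟩
  | one => exact ⟨[], rfl⟩
  | mul g h _ _ hg hh =>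
    obtain ⟨L, rfl⟩ := hg
    obtain ⟨M, rfl⟩ := hh
    exact ⟨L ++ M, by simp [wordProd]⟩
  | inv g _ hg =>
    obtain ⟨L, rfl⟩ := hg
    refine ⟨L.reverse, ?_⟩
    simp only [wordProd, List.prod_inv_reverse, List.map_reverse, List.map_map]
    congr 3
    funext i
    exact (hf.inv_affineReflection i).symm

lemma exists_affineRoot_comp (hf : IsSimpleAffineSystem Φ f) {g : V ≃ᵃ[ℝ] V}
    (hg : g ∈ simpleGroup f) {a : V × ℤ} (ha : a ∈ affineRoots Φ) :
    ∃ b ∈ affineRoots Φ, (∀ v, ev b v = ev a (g v)) ∧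
      affineReflection a * g = g * affineReflection b := by
  obtain ⟨L, rfl⟩ := hf.exists_wordProd_eq hg
  clear hg
  induction L generalizing a with
  | nil => exact ⟨a, ha, fun _ ↦ rfl, by simp [wordProd]⟩
  | cons i L ih =>
    obtain ⟨b, hb, h1, h2⟩ := ih (hf.reflect_mem (hf.mem i) ha)
    refine ⟨b, hb, fun v ↦ (h1 v).trans (hf.ev_reflect (hf.mem i) ha _), ?_⟩
    simp only [wordProd, List.map_cons, List.prod_cons] at h2 ⊢
    rw [← mul_assoc, hf.affineReflection_mul (hf.mem i) ha, mul_assoc, h2, mul_assoc]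

lemma exists_shorter (hf : IsSimpleAffineSystem Φ f) {x : V} (hx : x ∈ openAlcove f) (i : ι)
    (L : List ι) (hL : ev (f i) (wordProd f L x) < 0) :
    ∃ M : List ι, M.length < L.length ∧
      wordProd f M = affineReflection (f i) * wordProd f L := by
  induction L using List.reverseRecOn with
  | nil => exact absurd hL (hx i).le.not_gt
  | append_singleton L j ih =>
    have hprod : wordProd f (L ++ [j]) = wordProd f L * affineReflection (f j) := by
      simp [wordProd]
    have hmem : wordProd f L ∈ simpleGroup f :=
      Subgroup.list_prod_mem _ fun g hg ↦ by
        obtain ⟨k, -, rfl⟩ := List.mem_map.1 hg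
        exact Subgroup.subset_closure ⟨k, rfl⟩
    obtain ⟨b, hb, h1, h2⟩ := hf.exists_affineRoot_comp hmem (hf.mem i)
    by_cases hneg : ev (f i) (wordProd f L x) < 0
    · obtain ⟨M, hM, hM'⟩ := ih hneg
      refine ⟨M ++ [j], by simpa using hM, ?_⟩
      rw [hprod, ← mul_assoc, ← hM']
      simp [wordProd]
    · have hpos : 0 < ev b x := lt_of_le_of_ne (by rw [h1]; exact not_lt.1 hneg)
        (hf.ev_ne_zero hb hx).symm
      have hbj : b = f j := by
        by_contra hbj
        have := hf.reflect_pos hb hx hpos hbj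
        rw [h1] at this
        rw [hprod] at hL
        exact lt_asymm this hL
      refine ⟨L, by simp, ?_⟩
      rw [hprod, ← mul_assoc, h2, hbj, mul_assoc,
        affineReflection_mul_self (hf.fst_ne_zero (hf.mem j)), mul_one]

lemma wordProd_eq_one (hf : IsSimpleAffineSystem Φ f) {x : V} (hx : x ∈ openAlcove f)
    (L : List ι) (hL : wordProd f L x ∈ openAlcove f) : wordProd f L = 1 := by
  induction hn : L.length using Nat.strong_induction_on generalizing L with
  | _ n ih =>
    cases L with
    | nil => rfl
    | cons i L =>
      have hprod : wordProd f (i :: L) = affineReflection (f i) * wordProd f L := by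
        simp [wordProd]
      have hneg : ev (f i) (wordProd f L x) < 0 := by
        have h1 := hL i
        rw [hprod] at h1
        have h2 := ev_affineReflection_self (hf.fst_ne_zero (hf.mem i)) (wordProd f L x)
        change 0 < ev (f i) (affineReflection (f i) (wordProd f L x)) at h1
        linarith
      obtain ⟨M, hM, hM'⟩ := hf.exists_shorter hx i L hneg
      rw [hprod, ← hM'] at hL ⊢
      exact ih M.length (by simp at hn; omega) M hL rfl

/-- The simple affine group acts freely on the translates of the open alcove. -/
lemma eq_one_of_mem_openAlcove (hf : IsSimpleAffineSystem Φ f) {g : V ≃ᵃ[ℝ] V}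
    (hg : g ∈ simpleGroup f) {x : V} (hx : x ∈ openAlcove f) (hgx : g x ∈ openAlcove f) :
    g = 1 := by
  obtain ⟨L, rfl⟩ := hf.exists_wordProd_eq hg
  exact hf.wordProd_eq_one hx L hgx

/-- The affine roots separating `v` from `x`. -/
def separating (Φ : Finset V) (x v : V) : Set (V × ℤ) :=
  {a | a ∈ affineRoots Φ ∧ 0 < ev a x ∧ ev a v < 0}

lemma finite_separating (x v : V) : (separating Φ x v).Finite := by
  refine (Φ.finite_toSet.biUnion fun β _ ↦
    (Set.finite_Icc ⌊-(⟪β, x⟫ : ℝ)⌋ ⌈-(⟪β, v⟫ : ℝ)⌉).image (Prod.mk β)).subset ?_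
  rintro ⟨β, n⟩ ⟨hβ, h1, h2⟩
  simp only [ev] at h1 h2
  refine Set.mem_biUnion hβ ⟨n, ⟨?_, ?_⟩, rfl⟩
  · exact Int.floor_le_iff.2 (by linarith)
  · exact Int.le_ceil_iff.2 (by linarith)

lemma ncard_separating_lt (hf : IsSimpleAffineSystem Φ f) {x : V} (hx : x ∈ openAlcove f) {v : V}
    {i : ι} (hi : ev (f i) v < 0) :
    (separating Φ x (affineReflection (f i) v)).ncard < (separating Φ x v).ncard := by
  have hne := hf.fst_ne_zero (hf.mem i)
  have hinj : Set.InjOn (reflect (f i)) (separating Φ x (affineReflection (f i) v)) := by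
    intro a ha b hb hab
    refine ev_injective (funext fun w ↦ ?_)
    rw [← affineReflection_affineReflection hne w, ← hf.ev_reflect (hf.mem i) ha.1,
      ← hf.ev_reflect (hf.mem i) hb.1, hab]
  rw [← hinj.ncard_image]
  refine Set.ncard_lt_ncard ?_ (finite_separating x v)
  refine (Set.ssubset_iff_of_subset ?_).2 ⟨f i, ⟨hf.mem i, hx i, hi⟩, ?_⟩
  · rintro _ ⟨a, ⟨ha, h1, h2⟩, rfl⟩
    refine ⟨hf.reflect_mem (hf.mem i) ha, ?_, ?_⟩
    · rw [hf.ev_reflect (hf.mem i) ha]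
      refine hf.reflect_pos ha hx h1 ?_
      rintro rfl
      rw [ev_affineReflection_self hne] at h2
      linarith
    · rwa [hf.ev_reflect (hf.mem i) ha]
  · rintro ⟨a, ⟨ha, h1, h2⟩, hai⟩
    have h3 := hf.ev_reflect (hf.mem i) ha (affineReflection (f i) x)
    rw [hai, affineReflection_affineReflection hne, ev_affineReflection_self hne] at h3
    have := hx i
    linarith

/-- Every point can be moved into the closed alcove by the simple affine group. -/
lemma exists_mem_alcove (hf : IsSimpleAffineSystem Φ f) (v : V) :
    ∃ g ∈ simpleGroup f, g v ∈ alcove f := by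
  obtain ⟨x, hx⟩ := hf.openAlcove_nonempty
  induction hn : (separating Φ x v).ncard using Nat.strong_induction_on generalizing v with
  | _ n ih =>
    by_cases hv : v ∈ alcove f
    · exact ⟨1, one_mem _, hv⟩
    · obtain ⟨i, hi⟩ : ∃ i, ev (f i) v < 0 := by simpa [alcove] using hv
      obtain ⟨g, hg, hgv⟩ := ih _ (hn ▸ hf.ncard_separating_lt hx hi) _ rfl
      exact ⟨g * affineReflection (f i), mul_mem hg (Subgroup.subset_closure ⟨i, rfl⟩), hgv⟩

/-- All reflections in affine roots lie in the simple affine group. -/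
lemma affineReflection_mem (hf : IsSimpleAffineSystem Φ f) {a : V × ℤ}
    (ha : a ∈ affineRoots Φ) : affineReflection a ∈ simpleGroup f := by
  have := hf.nontrivial
  obtain ⟨x, hx⟩ := hf.openAlcove_nonempty
  obtain ⟨i₀, hi₀⟩ := Finite.exists_min fun i ↦ ev (f i) x
  suffices H : ∀ n : ℕ, ∀ a ∈ affineRoots Φ, 0 < ev a x → ev a x ≤ n * ev (f i₀) x →
      affineReflection a ∈ simpleGroup f by
    have H' : ∀ a ∈ affineRoots Φ, 0 < ev a x → affineReflection a ∈ simpleGroup f := by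
      intro a ha hax
      obtain ⟨n, hn⟩ := exists_nat_ge (ev a x / ev (f i₀) x)
      exact H n a ha hax ((div_le_iff₀ (hx i₀)).1 hn)
    rcases lt_or_gt_of_ne (hf.ev_ne_zero ha hx) with h | h
    · rw [← affineReflection_neg]
      exact H' _ (hf.neg_mem_affineRoots ha) (by rw [ev_neg]; linarith)
    · exact H' a ha h
  intro n
  induction n with
  | zero => intro a _ h1 h2; simp at h2; linarith
  | succ n ih =>
    intro a ha hax han
    obtain ⟨i, hi⟩ := hf.exists_inner_pos _ ha
    have hmem : affineReflection (f i) ∈ simpleGroup f := Subgroup.subset_closure ⟨i, rfl⟩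
    by_cases hai : a = f i
    · rwa [hai]
    have hpos := hf.reflect_pos ha hx hax hai
    rw [← hf.ev_reflect (hf.mem i) ha] at hpos
    have hk : 1 ≤ pairing (f i) a := by
      have : (0 : ℝ) < pairing (f i) a := by
        rw [hf.pairing_cast (hf.mem i) ha]
        exact div_pos (by linarith) (real_inner_self_pos.2 (hf.fst_ne_zero (hf.mem i)))
      exact_mod_cast this
    have hle : ev (reflect (f i) a) x ≤ n * ev (f i₀) x := by
      rw [reflect, sub_eq_add_neg, ev_add, ev_neg, ev_zsmul]
      have h1 : (1 : ℝ) ≤ pairing (f i) a := by exact_mod_cast hk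
      have h2 := le_mul_of_one_le_left (hx i).le h1
      have h3 := hi₀ i
      push_cast at han
      linarith
    have := ih _ (hf.reflect_mem (hf.mem i) ha) hpos hle
    have h := hf.affineReflection_mul (hf.mem i) ha
    rw [eq_mul_inv_iff_mul_eq.2 h]
    exact mul_mem (mul_mem hmem this) (inv_mem hmem)

lemma volume_image [FiniteDimensional ℝ V] [MeasurableSpace V] [BorelSpace V]
    (hf : IsSimpleAffineSystem Φ f) {g : V ≃ᵃ[ℝ] V} (hg : g ∈ simpleGroup f) (s : Set V) :
    MeasureTheory.volume (g '' s) = MeasureTheory.volume s := by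
  obtain ⟨L, rfl⟩ := hf.exists_wordProd_eq hg
  clear hg
  induction L with
  | nil => simp [wordProd]
  | cons i L ih =>
    have : wordProd f (i :: L) '' s = affineReflection (f i) '' (wordProd f L '' s) := by
      rw [Set.image_image]
      simp [wordProd]
    rw [this, volume_image_affineReflection, ih]

lemma isOpen_openAlcove : IsOpen (openAlcove f) := by
  simp only [openAlcove, Set.ofPred_forall]
  exact isOpen_iInter_of_finite fun i ↦ isOpen_lt continuous_const (continuous_ev _)

lemma volume_walls [FiniteDimensional ℝ V] [MeasurableSpace V] [BorelSpace V]
    (hf : IsSimpleAffineSystem Φ f) :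
    MeasureTheory.volume (⋃ a ∈ affineRoots Φ, {v | ev a v = 0}) = 0 := by
  have hcount : (affineRoots Φ).Countable := by
    refine (Φ.finite_toSet.countable.prod (Set.countable_univ (α := ℤ))).mono ?_
    exact fun a ha ↦ ⟨ha, trivial⟩
  refine (MeasureTheory.measure_biUnion_null_iff hcount).2 fun a ha ↦ ?_
  have hne := hf.fst_ne_zero ha
  have : {v | ev a v = 0} = (AffineSubspace.comap (innerSL ℝ a.1).toLinearMap.toAffineMap
      (AffineSubspace.mk' (-(a.2 : ℝ)) ⊥) : Set V) := by
    ext v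
    simp [ev, AffineSubspace.mem_mk']
  rw [this]
  refine MeasureTheory.Measure.addHaar_affineSubspace _ _ fun htop ↦ ?_
  have hall : ∀ v, ev a v = 0 := fun v ↦ by
    have : v ∈ {v | ev a v = 0} := by rw [this, htop]; trivial
    exact this
  have h1 := hall 0
  have h2 := hall a.1
  simp only [ev, inner_zero_right, zero_add] at h1 h2
  rw [h1, add_zero, inner_self_eq_zero] at h2
  exact hne h2

lemma image_inv_subset_smul_openAlcove (hf : IsSimpleAffineSystem Φ f) {m : ℕ} (hm : m ≠ 0)
    {w : V ≃ᵃ[ℝ] V} (hw : w ∈ simpleGroup f)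
    (hwC : ∀ v ∈ alcove f, w⁻¹ v ∈ (m : ℝ) • alcove f) :
    (w⁻¹ : V ≃ᵃ[ℝ] V) '' openAlcove f ⊆ (m : ℝ) • openAlcove f := by
  rintro _ ⟨u, hu, rfl⟩
  refine (mem_smul_openAlcove hm).2 fun i ↦ ?_
  obtain ⟨b, hb, h1, -⟩ := hf.exists_affineRoot_comp (inv_mem hw) (a := dilate m (f i)) (hf.mem i)
  have h2 := (mem_smul_alcove hm).1 (hwC u (openAlcove_subset hu)) i
  rw [← h1] at h2 ⊢
  exact lt_of_le_of_ne h2 (hf.ev_ne_zero hb hu).symm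

lemma exists_mem_image_inv (hf : IsSimpleAffineSystem Φ f) {m : ℕ} (hm : m ≠ 0) {v : V}
    (hv : v ∈ (m : ℝ) • openAlcove f) (hgen : ∀ a ∈ affineRoots Φ, ev a v ≠ 0) :
    ∃ w ∈ simpleGroup f, (∀ v ∈ alcove f, w⁻¹ v ∈ (m : ℝ) • alcove f) ∧
      v ∈ (w⁻¹ : V ≃ᵃ[ℝ] V) '' openAlcove f := by
  obtain ⟨w, hw, hwv⟩ := hf.exists_mem_alcove v
  have hinv : ∀ u, (w⁻¹ : V ≃ᵃ[ℝ] V) (w u) = u := fun u ↦ w.symm_apply_apply u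
  refine ⟨w, hw, fun c hc ↦ (mem_smul_alcove hm).2 fun i ↦ ?_, w v, fun i ↦ ?_, hinv v⟩
  · obtain ⟨b, hb, h1, -⟩ :=
      hf.exists_affineRoot_comp (inv_mem hw) (a := dilate m (f i)) (hf.mem i)
    have h2 := (mem_smul_openAlcove hm).1 hv i
    rw [← hinv v, ← h1] at h2
    rw [← h1]
    exact hf.ev_nonneg_of_ev_pos hb hwv h2 hc
  · obtain ⟨b, hb, h1, -⟩ := hf.exists_affineRoot_comp hw (hf.mem i)
    refine lt_of_le_of_ne (hwv i) ?_
    rw [← h1]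
    exact (hgen b hb).symm

/-- The alcoves contained in the `m`-fold dilate of the fundamental alcove are `m ^ rank` many. -/
theorem card_alcoves_in_dilate [FiniteDimensional ℝ V] (hf : IsSimpleAffineSystem Φ f)
    {m : ℕ} (hm : m ≠ 0) :
    Nat.card {w : V ≃ᵃ[ℝ] V // w ∈ simpleGroup f ∧
      ∀ v ∈ alcove f, w⁻¹ v ∈ (m : ℝ) • alcove f} = m ^ Module.finrank ℝ V := by
  let : MeasurableSpace V := borel V
  have : BorelSpace V := ⟨rfl⟩
  let T := {w : V ≃ᵃ[ℝ] V // w ∈ simpleGroup f ∧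
      ∀ v ∈ alcove f, w⁻¹ v ∈ (m : ℝ) • alcove f}
  let A : T → Set V := fun w ↦ (w.1⁻¹ : V ≃ᵃ[ℝ] V) '' openAlcove f
  have hopen : ∀ w, IsOpen (A w) := fun w ↦
    (AffineEquiv.toContinuousAffineEquiv (w.1⁻¹)).toHomeomorph.isOpenMap _ isOpen_openAlcove
  have hdisj : Pairwise (Function.onFun Disjoint A) := by
    intro w w' hne
    refine Set.disjoint_left.2 ?_
    rintro _ ⟨u, hu, rfl⟩ ⟨u', hu', h⟩
    have h1 : (w.1 * w'.1⁻¹) u' = u := by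
      change w.1 (w'.1⁻¹ u') = u
      rw [h]
      exact w.1.apply_symm_apply u
    have h2 := hf.eq_one_of_mem_openAlcove (mul_mem w.2.1 (inv_mem w'.2.1)) hu' (h1 ▸ hu)
    exact hne (Subtype.ext (mul_inv_eq_one.1 h2))
  have hcount : Countable T := hdisj.countable_of_isOpen_disjoint hopen
    fun w ↦ hf.openAlcove_nonempty.image _
  have hsub : (⋃ w, A w) ⊆ (m : ℝ) • openAlcove f := Set.iUnion_subset fun w ↦
    hf.image_inv_subset_smul_openAlcove hm w.2.1 w.2.2
  have hcover : (m : ℝ) • openAlcove f ⊆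
      (⋃ w, A w) ∪ ⋃ a ∈ affineRoots Φ, {v | ev a v = 0} := by
    intro v hv
    by_cases hgen : ∀ a ∈ affineRoots Φ, ev a v ≠ 0
    · obtain ⟨w, hw, hwC, hwv⟩ := hf.exists_mem_image_inv hm hv hgen
      exact Or.inl (Set.mem_iUnion.2 ⟨⟨w, hw, hwC⟩, hwv⟩)
    · right
      push Not at hgen
      simpa using hgen
  have hvol : MeasureTheory.volume ((m : ℝ) • openAlcove f) = MeasureTheory.volume (⋃ w, A w) := by
    refine le_antisymm ((MeasureTheory.measure_mono hcover).trans
      ((MeasureTheory.measure_union_le _ _).trans ?_)) (MeasureTheory.measure_mono hsub)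
    rw [hf.volume_walls, add_zero]
  rw [MeasureTheory.measure_iUnion hdisj fun w ↦ (hopen w).measurableSet,
    MeasureTheory.Measure.addHaar_smul,
    tsum_congr fun w : T ↦ hf.volume_image (inv_mem w.2.1) (openAlcove f), ENNReal.tsum_const,
    ENNReal.mul_left_inj
      (isOpen_openAlcove.measure_pos MeasureTheory.volume hf.openAlcove_nonempty).ne'
      (hf.isBounded.subset openAlcove_subset).measure_lt_top.ne] at hvol
  rw [abs_of_nonneg (by positivity), ← Nat.cast_pow, ENNReal.ofReal_natCast] at hvol
  change ENat.toNat (ENat.card T) = _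
  have : ENat.card T = (m ^ Module.finrank ℝ V : ℕ) := by exact_mod_cast hvol.symm
  rw [this, ENat.toNat_natCast]

end IsSimpleAffineSystem

/-- The simple affine roots: `1 - θ` and the simple roots. -/
def simpleAffineRoots {ℓ : ℕ} (α : Fin ℓ → V) (θ : V) (o : Option (Fin ℓ)) : V × ℤ :=
  o.elim (-θ, 1) fun i ↦ (α i, 0)

@[simp] lemma ev_simpleAffineRoots_none {ℓ : ℕ} (α : Fin ℓ → V) (θ v : V) :
    ev (simpleAffineRoots α θ none) v = 1 - ⟪θ, v⟫ := by
  simp [ev, simpleAffineRoots]; ring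

@[simp] lemma ev_simpleAffineRoots_some {ℓ : ℕ} (α : Fin ℓ → V) (θ : V) (i : Fin ℓ) (v : V) :
    ev (simpleAffineRoots α θ (some i)) v = ⟪α i, v⟫ := by
  simp [ev, simpleAffineRoots]

lemma alcove_simpleAffineRoots {ℓ : ℕ} (α : Fin ℓ → V) (θ : V) :
    alcove (simpleAffineRoots α θ) = {v : V | (∀ i, 0 ≤ ⟪α i, v⟫) ∧ ⟪θ, v⟫ ≤ 1} := by
  ext v
  simp [alcove, Option.forall, and_comm]

lemma exists_equiv_inner [FiniteDimensional ℝ V] {ℓ : ℕ} (hdim : Module.finrank ℝ V = ℓ)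
    {α : Fin ℓ → V} (hα : Submodule.span ℝ (Set.range α) = ⊤) :
    ∃ e : V ≃ₗ[ℝ] (Fin ℓ → ℝ), ∀ v i, e v i = ⟪α i, v⟫ := by
  let L : V →ₗ[ℝ] (Fin ℓ → ℝ) := LinearMap.pi fun i ↦ (innerSL ℝ (α i)).toLinearMap
  have hL : Function.Injective L := by
    refine (injective_iff_map_eq_zero L).2 fun v hv ↦ ?_
    have h : ∀ u ∈ Submodule.span ℝ (Set.range α), ⟪u, v⟫ = (0 : ℝ) := by
      intro u hu
      induction hu using Submodule.span_induction with
      | mem u hu =>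
        obtain ⟨i, rfl⟩ := hu
        exact congrFun hv i
      | zero => simp
      | add u w _ _ hu hw => rw [inner_add_left, hu, hw, add_zero]
      | smul c u _ hu => rw [real_inner_smul_left, hu, mul_zero]
    exact inner_self_eq_zero.1 (h v (hα ▸ Submodule.mem_top))
  exact ⟨L.linearEquivOfInjective hL (by simpa using hdim), fun v i ↦ rfl⟩

lemma isSimpleAffineSystem_simpleAffineRoots [FiniteDimensional ℝ V] {ℓ : ℕ}
    (hdim : Module.finrank ℝ V = ℓ) {Φ : Finset V} (h0 : (0 : V) ∉ Φ)
    (hspan : Submodule.span ℝ (Φ : Set V) = ⊤)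
    (hsym : ∀ β ∈ Φ, -β ∈ Φ)
    (hreduced : ∀ β ∈ Φ, ∀ c : ℝ, c • β ∈ Φ → c = 1 ∨ c = -1)
    (hcrys : ∀ β ∈ Φ, ∀ γ ∈ Φ, ∃ n : ℤ, 2 * ⟪β, γ⟫ / ⟪β, β⟫ = (n : ℝ))
    (hrefl : ∀ β ∈ Φ, ∀ γ ∈ Φ, γ - (2 * ⟪β, γ⟫ / ⟪β, β⟫) • β ∈ Φ)
    {α : Fin ℓ → V} (hα : ∀ i, α i ∈ Φ)
    (hbase : ∀ β ∈ Φ, ∃ c : Fin ℓ → ℤ,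
      β = ∑ i, (c i : ℝ) • α i ∧ ((∀ i, 0 ≤ c i) ∨ (∀ i, c i ≤ 0)))
    {θ : V} (hθ : θ ∈ Φ)
    (hhighest : ∀ β ∈ Φ, ∃ c : Fin ℓ → ℕ, θ - β = ∑ i, (c i : ℝ) • α i) :
    IsSimpleAffineSystem Φ (simpleAffineRoots α θ) := by
  have hspanα : Submodule.span ℝ (Set.range α) = ⊤ := by
    refine top_le_iff.1 (hspan ▸ Submodule.span_le.2 fun β hβ ↦ ?_)
    obtain ⟨c, rfl, -⟩ := hbase β hβ
    exact Submodule.sum_mem _ fun i _ ↦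
      Submodule.smul_mem _ _ (Submodule.subset_span ⟨i, rfl⟩)
  obtain ⟨e, he⟩ := exists_equiv_inner hdim hspanα
  have hmarks : ∃ m : Fin ℓ → ℕ, (∀ i, 1 ≤ m i) ∧ θ = ∑ i, (m i : ℝ) • α i := by
    obtain ⟨c, hc, -⟩ := hbase θ hθ
    have h1 : ∀ i, 1 ≤ c i := by
      intro i
      obtain ⟨d, hd⟩ := hhighest (α i) (hα i)
      have hv : ∀ j, ⟪α j, e.symm (Pi.single i 1)⟫ = Pi.single (M := fun _ ↦ ℝ) i 1 j :=
        fun j ↦ by rw [← he, e.apply_symm_apply]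
      have h2 := congrArg (fun u ↦ (⟪u, e.symm (Pi.single i 1)⟫ : ℝ)) hd
      rw [hc] at h2
      simp only [inner_sub_left, sum_inner, real_inner_smul_left, hv, Pi.single_apply, mul_ite,
        mul_one, mul_zero, Finset.sum_ite_eq', Finset.mem_univ, if_true] at h2
      have : (0 : ℝ) ≤ d i := Nat.cast_nonneg _
      exact_mod_cast (by linarith : (1 : ℝ) ≤ c i)
    refine ⟨fun i ↦ (c i).toNat, fun i ↦ by have := h1 i; dsimp only; omega, hc.trans ?_⟩
    refine Finset.sum_congr rfl fun i _ ↦ ?_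
    have : ((c i).toNat : ℤ) = c i := Int.toNat_of_nonneg (by linarith [h1 i])
    rw [← Int.cast_natCast, this]
  obtain ⟨m, hm1, hm⟩ := hmarks
  have hm0 : ∀ i, (1 : ℝ) ≤ m i := fun i ↦ by exact_mod_cast hm1 i
  have hθinner : ∀ v, (⟪θ, v⟫ : ℝ) = ∑ i, m i * ⟪α i, v⟫ := fun v ↦ by
    conv_lhs => rw [hm]
    simp only [sum_inner, real_inner_smul_left]
  have hpos : ∀ β ∈ Φ, ∀ n : ℕ, ∃ c : Option (Fin ℓ) → ℕ,
      ((β, (n : ℤ) + 1) : V × ℤ) = ∑ i, c i • simpleAffineRoots α θ i := by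
    intro β hβ n
    obtain ⟨d, hd⟩ := hhighest (-β) (hsym β hβ)
    refine ⟨fun o ↦ o.elim (n + 1) fun i ↦ d i + n * m i, ?_⟩
    rw [Fintype.sum_option]
    refine Prod.ext ?_ ?_
    · have : ∑ i, ((d i + n * m i : ℕ) : ℝ) • α i = (θ - -β) + (n : ℝ) • θ := by
        rw [hd]
        conv_rhs => rw [hm]
        simp only [Finset.smul_sum, ← Finset.sum_add_distrib, smul_smul, ← add_smul]
        push_cast
        rfl
      simp only [simpleAffineRoots, Option.elim, Prod.fst_add, Prod.fst_sum, Prod.smul_fst]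
      simp only [← Nat.cast_smul_eq_nsmul ℝ]
      rw [this]
      push_cast
      module
    · simp [simpleAffineRoots, Prod.snd_sum]
  refine
    { zero_notMem := h0
      neg_mem := hsym
      reduced := hreduced
      crystallographic := hcrys
      reflection_mem := hrefl
      mem := ?_
      pos_or_neg := ?_
      exists_vertex := ?_
      nontrivial := ?_
      exists_inner_pos := ?_
      isBounded := ?_ }
  · rintro (_ | i)
    exacts [hsym θ hθ, hα i]
  · have hzero : ∀ c : Fin ℓ → ℤ, (∀ i, 0 ≤ c i) → ∃ d : Option (Fin ℓ) → ℕ,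
        ((∑ i, (c i : ℝ) • α i, 0) : V × ℤ) = ∑ i, d i • simpleAffineRoots α θ i := by
      intro c hc
      refine ⟨fun o ↦ o.elim 0 fun i ↦ (c i).toNat, ?_⟩
      rw [Fintype.sum_option]
      refine Prod.ext ?_ ?_
      · simp only [simpleAffineRoots, Option.elim, Prod.fst_sum, Prod.smul_fst,
          zero_smul, zero_add]
        refine Finset.sum_congr rfl fun i _ ↦ ?_
        rw [← natCast_zsmul, Int.toNat_of_nonneg (hc i), Int.cast_smul_eq_zsmul]
      · simp [simpleAffineRoots, Prod.snd_sum]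
    rintro ⟨β, n⟩ hβ
    rcases lt_trichotomy n 0 with hn | rfl | hn
    · right
      obtain ⟨k, rfl⟩ : ∃ k : ℕ, n = -(k + 1) := ⟨(-n - 1).toNat, by omega⟩
      simpa using hpos (-β) (hsym β hβ) k
    · obtain ⟨c, rfl, hc | hc⟩ := hbase β hβ
      · exact Or.inl (hzero c hc)
      · right
        simpa using hzero (-c) fun i ↦ by simpa using hc i
    · left
      obtain ⟨k, rfl⟩ : ∃ k : ℕ, n = k + 1 := ⟨(n - 1).toNat, by omega⟩
      exact hpos β hβ k
  · classical
    intro J hJ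
    let M : Option (Fin ℓ) → ℝ := fun o ↦ o.elim 1 fun i ↦ m i
    have hM : ∀ o, 0 < M o := by
      rintro (_ | i)
      exacts [one_pos, one_pos.trans_le (hm0 i)]
    let S : ℝ := ∑ o, if o ∈ J then M o else 0
    have hS : 0 < S := by
      obtain ⟨o, ho⟩ := hJ
      refine Finset.sum_pos' (fun o _ ↦ ?_) ⟨o, Finset.mem_univ _, by simpa [ho] using hM o⟩
      split_ifs
      exacts [(hM o).le, le_rfl]
    let s : Option (Fin ℓ) → ℝ := fun o ↦ if o ∈ J then S⁻¹ else 0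
    have hsum : ∑ o, M o * s o = 1 := by
      rw [← mul_inv_cancel₀ hS.ne', Finset.sum_mul]
      refine Finset.sum_congr rfl fun o _ ↦ ?_
      simp only [s]
      split_ifs <;> simp
    have hv : ∀ j, ⟪α j, e.symm fun i ↦ s (some i)⟫ = s (some j) := fun j ↦ by
      rw [← he, e.apply_symm_apply]
    have hev : ∀ o, ev (simpleAffineRoots α θ o) (e.symm fun i ↦ s (some i)) = s o := by
      rintro (_ | i)
      · rw [ev_simpleAffineRoots_none, hθinner, ← hsum, Fintype.sum_option]
        simp [hv, M]
      · rw [ev_simpleAffineRoots_some, hv]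
    refine ⟨e.symm fun i ↦ s (some i), fun o ↦ ?_⟩
    rw [hev]
    exact ⟨fun ho ↦ by simpa [s, ho] using hS, fun ho ↦ by simp [s, ho]⟩
  · by_contra hcon
    have : IsEmpty (Fin ℓ) := ⟨fun i ↦ hcon ⟨none, some i, by simp⟩⟩
    exact h0 (by simpa [hm] using hθ)
  · intro β hβ
    by_contra! hcon
    have hle : ∀ i, ⟪α i, β⟫ ≤ (0 : ℝ) := fun i ↦ hcon (some i)
    have hθβ : (0 : ℝ) ≤ ⟪θ, β⟫ := by simpa [simpleAffineRoots] using hcon none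
    have hterm : ∀ i ∈ Finset.univ, (m i : ℝ) * ⟪α i, β⟫ ≤ 0 := fun i _ ↦
      mul_nonpos_of_nonneg_of_nonpos (Nat.cast_nonneg _) (hle i)
    have hzero := (Finset.sum_eq_zero_iff_of_nonpos hterm).1
      (le_antisymm (Finset.sum_nonpos hterm) (hθinner β ▸ hθβ))
    have : β = 0 := e.map_eq_zero_iff.1 <| funext fun i ↦ by
      rw [he]
      exact (mul_eq_zero.1 (hzero i (Finset.mem_univ i))).resolve_left (by linarith [hm0 i])
    exact h0 (this ▸ hβ)
  · refine (((isCompact_Icc (a := (0 : Fin ℓ → ℝ)) (b := 1)).image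
      e.symm.toContinuousLinearEquiv.continuous).isBounded).subset fun v hv ↦ ?_
    have hv0 : ∀ i, (0 : ℝ) ≤ ⟪α i, v⟫ := fun i ↦ by simpa using hv (some i)
    have hv1 : (⟪θ, v⟫ : ℝ) ≤ 1 := by simpa using hv none
    refine ⟨e v, ⟨fun i ↦ by simpa [he] using hv0 i, fun i ↦ ?_⟩, e.symm_apply_apply v⟩
    rw [he]
    refine le_trans ?_ hv1
    rw [hθinner]
    exact (le_mul_of_one_le_left (hv0 i) (hm0 i)).trans
      (Finset.single_le_sum (f := fun i ↦ (m i : ℝ) * ⟪α i, v⟫)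
        (fun j _ ↦ mul_nonneg (Nat.cast_nonneg _) (hv0 j)) (Finset.mem_univ i))

lemma closure_eq_simpleGroup {ℓ : ℕ} {Φ : Finset V} {α : Fin ℓ → V} {θ : V} (hθ : θ ∈ Φ)
    (hα : ∀ i, α i ∈ Φ) (hf : IsSimpleAffineSystem Φ (simpleAffineRoots α θ)) :
    Subgroup.closure
        ({g : V ≃ᵃ[ℝ] V | ∃ β ∈ Φ, ∀ v, g v = v - (2 * ⟪β, v⟫ / ⟪β, β⟫) • β} ∪
         {g : V ≃ᵃ[ℝ] V | ∃ q ∈ AddSubgroup.closure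
            {q : V | ∃ β ∈ Φ, q = (2 / ⟪β, β⟫) • β}, ∀ v, g v = q + v}) =
      simpleGroup (simpleAffineRoots α θ) := by
  have hlin : ∀ (β : V) (g : V ≃ᵃ[ℝ] V), (∀ v, g v = v - (2 * ⟪β, v⟫ / ⟪β, β⟫) • β) →
      g = affineReflection (β, 0) := fun β g hg ↦ by
    ext v
    rw [hg, affineReflection_apply]
    simp [ev]
  have htrans : ∀ β : V, β ≠ 0 → ∀ n : ℤ, affineReflection (β, n) =
      AffineEquiv.constVAdd ℝ V (-(n : ℝ) • (2 / ⟪β, β⟫ : ℝ) • β) * affineReflection (β, 0) := by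
    intro β hβ n
    ext v
    change _ = -(n : ℝ) • (2 / ⟪β, β⟫ : ℝ) • β + affineReflection (β, 0) v
    simp only [affineReflection_apply, ev, Int.cast_zero, add_zero]
    module
  refine le_antisymm ((Subgroup.closure_le _).2 (Set.union_subset ?_ ?_))
    ((Subgroup.closure_le _).2 ?_)
  · rintro g ⟨β, hβ, hg⟩
    rw [hlin β g hg]
    exact hf.affineReflection_mem hβ
  · rintro g ⟨q, hq, hg⟩
    obtain rfl : g = AffineEquiv.constVAdd ℝ V q := AffineEquiv.ext hg
    clear hg
    change AffineEquiv.constVAdd ℝ V q ∈ simpleGroup (simpleAffineRoots α θ)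
    induction hq using AddSubgroup.closure_induction with
    | mem q hq =>
      obtain ⟨β, hβ, rfl⟩ := hq
      have hne : β ≠ 0 := fun h ↦ hf.zero_notMem (h ▸ hβ)
      have h := eq_mul_inv_iff_mul_eq.2 (htrans β hne (-1)).symm
      simp only [Int.cast_neg, Int.cast_one, neg_neg, one_smul] at h
      rw [h]
      exact mul_mem (hf.affineReflection_mem hβ) (inv_mem (hf.affineReflection_mem hβ))
    | zero => exact AffineEquiv.constVAdd_zero ℝ V ▸ one_mem _
    | add p q _ _ hp hq =>
      rw [AffineEquiv.constVAdd_add]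
      exact mul_mem hp hq
    | neg q _ hq =>
      rw [← AffineEquiv.constVAdd_symm]
      exact inv_mem hq
  · have hroot : ∀ β ∈ Φ, ∀ v, affineReflection (β, 0) v =
        v - (2 * ⟪β, v⟫ / ⟪β, β⟫) • β := fun β _ v ↦ by
      rw [affineReflection_apply]
      simp [ev]
    rintro _ ⟨_ | i, rfl⟩
    · have hne : θ ≠ 0 := fun h ↦ hf.zero_notMem (h ▸ hθ)
      have : affineReflection (simpleAffineRoots α θ none) =
          AffineEquiv.constVAdd ℝ V ((2 / ⟪θ, θ⟫ : ℝ) • θ) * affineReflection (θ, 0) := by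
        rw [← affineReflection_neg]
        simpa [simpleAffineRoots] using htrans θ hne (-1)
      change affineReflection (simpleAffineRoots α θ none) ∈ _
      rw [this]
      exact mul_mem
        (Subgroup.subset_closure (Or.inr
          ⟨_, AddSubgroup.subset_closure ⟨θ, hθ, rfl⟩, fun v ↦ rfl⟩))
        (Subgroup.subset_closure (Or.inl ⟨θ, hθ, hroot θ hθ⟩))
    · exact Subgroup.subset_closure (Or.inl ⟨α i, hα i, hroot _ (hα i)⟩)

end AffineWeyl

/-- Let `Φ` be the root system of a complex simple Lie algebra of rank `ℓ`,
realized (via the Killing form) as a finite set of nonzero vectors spanning an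
`ℓ`-dimensional real inner product space `V` (a reduced, irreducible, crystallographic root
system), with simple roots `α 1, …, α ℓ` and highest root `θ`.  Let `C` be the fundamental
alcove `{v : ⟪α i, v⟫ ≥ 0 ∀ i, ⟪θ, v⟫ ≤ 1}`, let `Q∨` be the coroot lattice (the additive
subgroup generated by the coroots `2β/⟪β,β⟫`, `β ∈ Φ`), and let `Aff W` be the affine Weyl
group: the group of affine automorphisms of `V` generated by the reflections in the roots
together with the translations by elements of `Q∨` (so `Aff W = W ⋉ Q∨`).  Then the number
of elements `w ∈ Aff W` with `w⁻¹ C ⊆ 2C` is exactly `2 ^ ℓ`. -/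
theorem cdsw_card_affine_weyl_elements_in_double_alcove
    (ℓ : ℕ) (V : Type*) [NormedAddCommGroup V] [InnerProductSpace ℝ V]
    [FiniteDimensional ℝ V] (hdim : Module.finrank ℝ V = ℓ)
    -- the root system `Φ`:
    (Φ : Finset V)
    (h0 : (0 : V) ∉ Φ)
    (hspan : Submodule.span ℝ (Φ : Set V) = ⊤)
    (hsym : ∀ β ∈ Φ, -β ∈ Φ)
    (hreduced : ∀ β ∈ Φ, ∀ c : ℝ, c • β ∈ Φ → c = 1 ∨ c = -1)
    (hcrys : ∀ β ∈ Φ, ∀ γ ∈ Φ, ∃ n : ℤ, 2 * ⟪β, γ⟫ / ⟪β, β⟫ = (n : ℝ))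
    (hrefl : ∀ β ∈ Φ, ∀ γ ∈ Φ, γ - (2 * ⟪β, γ⟫ / ⟪β, β⟫) • β ∈ Φ)
    (hirred : ∀ Φ₁ Φ₂ : Set V, (Φ : Set V) = Φ₁ ∪ Φ₂ →
      (∀ β ∈ Φ₁, ∀ γ ∈ Φ₂, ⟪β, γ⟫ = 0) → Φ₁ = ∅ ∨ Φ₂ = ∅)
    -- the simple roots `α i`:
    (α : Fin ℓ → V) (hα : ∀ i, α i ∈ Φ)
    (hbase : ∀ β ∈ Φ, ∃ c : Fin ℓ → ℤ,
      β = ∑ i, (c i : ℝ) • α i ∧ ((∀ i, 0 ≤ c i) ∨ (∀ i, c i ≤ 0)))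
    -- the highest root `θ`:
    (θ : V) (hθ : θ ∈ Φ)
    (hhighest : ∀ β ∈ Φ, ∃ c : Fin ℓ → ℕ, θ - β = ∑ i, (c i : ℝ) • α i) :
    -- the fundamental alcove `C`:
    Nat.card {w : V ≃ᵃ[ℝ] V //
      w ∈ Subgroup.closure
        ({g : V ≃ᵃ[ℝ] V | ∃ β ∈ Φ, ∀ v, g v = v - (2 * ⟪β, v⟫ / ⟪β, β⟫) • β} ∪
         {g : V ≃ᵃ[ℝ] V | ∃ q ∈ AddSubgroup.closure
            {q : V | ∃ β ∈ Φ, q = (2 / ⟪β, β⟫) • β}, ∀ v, g v = q + v}) ∧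
      ∀ v ∈ {v : V | (∀ i, 0 ≤ ⟪α i, v⟫) ∧ ⟪θ, v⟫ ≤ 1},
        w⁻¹ v ∈ (2 : ℝ) • {v : V | (∀ i, 0 ≤ ⟪α i, v⟫) ∧ ⟪θ, v⟫ ≤ 1}}
    = 2 ^ ℓ := by
  have hf := AffineWeyl.isSimpleAffineSystem_simpleAffineRoots hdim h0 hspan hsym hreduced hcrys
    hrefl hα hbase hθ hhighest
  have h := hf.card_alcoves_in_dilate two_ne_zero
  rw [hdim, Nat.cast_ofNat, AffineWeyl.alcove_simpleAffineRoots] at h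
  rw [AffineWeyl.closure_eq_simpleGroup hθ hα hf]
  exact h
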